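/- For every finite simple undirected graph G = (V, E), the maximum of the profit p(F) over all subsets F ⊆ E equals |E| minus the minimum size of a maximal matching of G. -/

import Mathlib

/-- An edge `e` is covered by a set of edges `F` if `e ∈ F` or `e` shares an
endpoint with some edge of `F`. -/
def EdgeCovered {V : Type*} (F : Finset (Sym2 V)) (e : Sym2 V) : Prop :=
  e ∈ F ∨ ∃ f ∈ F, ∃ v : V, v ∈ e ∧ v ∈ f

/-- A set of edges is a matching if its edges are pairwise non-adjacent
(no two distinct edges share an endpoint). -/
def IsMatchingSet {V : Type*} (M : Finset (Sym2 V)) : Prop :=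
  ∀ e ∈ M, ∀ f ∈ M, e ≠ f → ∀ v : V, ¬ (v ∈ e ∧ v ∈ f)

/-- A maximal matching of `G`: a matching consisting of edges of `G` to which
no further edge of `G` can be added while keeping it a matching. -/
def IsMaximalMatching {V : Type*} [Fintype V] [DecidableEq V] (G : SimpleGraph V)
    [DecidableRel G.Adj] (M : Finset (Sym2 V)) : Prop :=
  M ⊆ G.edgeFinset ∧ IsMatchingSet M ∧
    ∀ e ∈ G.edgeFinset, e ∉ M → ¬ IsMatchingSet (insert e M)

/-- An edge dominating set of `G`: a set of edges of `G` covering every edge of `G`. -/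
def IsEdgeDominatingSet {V : Type*} [Fintype V] [DecidableEq V] (G : SimpleGraph V)
    [DecidableRel G.Adj] (F : Finset (Sym2 V)) : Prop :=
  F ⊆ G.edgeFinset ∧ ∀ e ∈ G.edgeFinset, EdgeCovered F e

open Classical in
/-- The profit of a subset `F` of the edges of `G`: the number of edges of `G`
covered by `F`, minus `|F|`. -/
noncomputable def edgeProfit {V : Type*} [Fintype V] [DecidableEq V] (G : SimpleGraph V)
    [DecidableRel G.Adj] (F : Finset (Sym2 V)) : ℤ :=
  ((G.edgeFinset.filter (fun e => EdgeCovered F e)).card : ℤ) - F.card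

theorem edgeCovered_iff {V : Type*} {F : Finset (Sym2 V)} {e : Sym2 V} :
    EdgeCovered F e ↔ ∃ f ∈ F, ∃ v : V, v ∈ e ∧ v ∈ f := by
  refine ⟨?_, Or.inr⟩
  rintro (h | h)
  · exact ⟨e, h, e.out.1, e.out_fst_mem, e.out_fst_mem⟩
  · exact h

section

variable {V : Type*} [Fintype V] [DecidableEq V] {G : SimpleGraph V} [DecidableRel G.Adj]

theorem isEdgeDominatingSet_edgeFinset : IsEdgeDominatingSet G G.edgeFinset :=
  ⟨subset_rfl, fun _ he => Or.inl he⟩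

theorem IsMaximalMatching.isEdgeDominatingSet {M : Finset (Sym2 V)}
    (hM : IsMaximalMatching G M) : IsEdgeDominatingSet G M := by
  obtain ⟨hsub, hmatch, hmax⟩ := hM
  refine ⟨hsub, fun e he => ?_⟩
  by_contra hc
  have hc' : e ∉ M ∧ ∀ f ∈ M, ∀ v : V, v ∈ e → v ∉ f := by
    simpa [EdgeCovered] using hc
  refine hmax e he hc'.1 fun a ha b hb hab v hv => ?_
  rcases Finset.mem_insert.1 ha with rfl | haM <;>
    rcases Finset.mem_insert.1 hb with rfl | hbM
  · exact hab rfl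
  · exact hc'.2 b hbM v hv.1 hv.2
  · exact hc'.2 a haM v hv.2 hv.1
  · exact hmatch a haM b hbM hab v hv

theorem IsEdgeDominatingSet.isMaximalMatching {M : Finset (Sym2 V)}
    (hM : IsEdgeDominatingSet G M) (hmatch : IsMatchingSet M) : IsMaximalMatching G M := by
  refine ⟨hM.1, hmatch, fun e he heM hins => ?_⟩
  obtain ⟨f, hf, v, hve, hvf⟩ := edgeCovered_iff.1 (hM.2 e he)
  exact hins e (Finset.mem_insert_self _ _) f (Finset.mem_insert_of_mem hf)
    (fun h => heM (h ▸ hf)) v ⟨hve, hvf⟩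

/-- The vertices that are not an endpoint of any edge of `D`. -/
def unsaturatedVertices (D : Finset (Sym2 V)) : Finset V :=
  Finset.univ.filter fun v => ∀ f ∈ D, v ∉ f

/-- An edge dominating set that is not a matching can be modified, without increasing its size,
so that twice its size plus the number of unsaturated vertices decreases. -/
theorem IsEdgeDominatingSet.exists_improvement {D : Finset (Sym2 V)}
    (hD : IsEdgeDominatingSet G D) (hnot : ¬ IsMatchingSet D) :
    ∃ D' : Finset (Sym2 V), IsEdgeDominatingSet G D' ∧ D'.card ≤ D.card ∧
      2 * D'.card + (unsaturatedVertices D').card <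
        2 * D.card + (unsaturatedVertices D).card := by
  simp only [IsMatchingSet, not_forall, not_not] at hnot
  obtain ⟨e, he, f, hf, hef, v, hve, hvf⟩ := hnot
  obtain ⟨w, rfl⟩ := Sym2.mem_iff_exists.1 hvf
  have heE : e ∈ D.erase s(v, w) := Finset.mem_erase.2 ⟨hef, he⟩
  have hcard := Finset.card_erase_add_one hf
  by_cases hdom : IsEdgeDominatingSet G (D.erase s(v, w))
  · refine ⟨_, hdom, by omega, ?_⟩
    have hsub : unsaturatedVertices (D.erase s(v, w)) ⊆ insert w (unsaturatedVertices D) := by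
      intro u hu
      simp only [unsaturatedVertices, Finset.mem_filter, Finset.mem_univ, true_and,
        Finset.mem_insert] at hu ⊢
      by_cases huw : u = w
      · exact Or.inl huw
      refine Or.inr fun g hg hug => ?_
      by_cases hgf : g = s(v, w)
      · subst hgf
        rcases Sym2.mem_iff.1 hug with rfl | h
        · exact hu e heE hve
        · exact huw h
      · exact hu g (Finset.mem_erase.2 ⟨hgf, hg⟩) hug
    have h1 := Finset.card_le_card hsub
    have h2 := Finset.card_insert_le w (unsaturatedVertices D)
    omega
  · have hsubE : D.erase s(v, w) ⊆ G.edgeFinset := (Finset.erase_subset _ _).trans hD.1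
    obtain ⟨g, hg, hgc⟩ : ∃ g ∈ G.edgeFinset, ¬ EdgeCovered (D.erase s(v, w)) g := by
      by_contra! h
      exact hdom ⟨hsubE, h⟩
    have hgc' : ∀ a ∈ D.erase s(v, w), ∀ u : V, u ∈ g → u ∉ a := by
      intro a ha u hu hua
      exact hgc (Or.inr ⟨a, ha, u, hu, hua⟩)
    have hvg : v ∉ g := fun h => hgc' e heE v h hve
    have hwg : w ∈ g := by
      obtain ⟨a, ha, u, hug, hua⟩ := edgeCovered_iff.1 (hD.2 g hg)
      by_cases haf : a = s(v, w)
      · subst haf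
        rcases Sym2.mem_iff.1 hua with rfl | rfl
        · exact absurd hug hvg
        · exact hug
      · exact absurd hua (hgc' a (Finset.mem_erase.2 ⟨haf, ha⟩) u hug)
    obtain ⟨x, rfl⟩ := Sym2.mem_iff_exists.1 hwg
    have hxw : x ≠ w := by
      have : G.Adj w x := by simpa using hg
      exact this.ne'
    have hxv : x ≠ v := fun h => hvg (h ▸ Sym2.mem_mk_right w x)
    have hcard' := Finset.card_insert_le s(w, x) (D.erase s(v, w))
    refine ⟨insert s(w, x) (D.erase s(v, w)),
      ⟨Finset.insert_subset hg hsubE, fun a ha => ?_⟩, by omega, ?_⟩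
    · obtain ⟨b, hb, u, hua, hub⟩ := edgeCovered_iff.1 (hD.2 a ha)
      by_cases hbf : b = s(v, w)
      · subst hbf
        rcases Sym2.mem_iff.1 hub with rfl | rfl
        · exact Or.inr ⟨e, Finset.mem_insert_of_mem heE, u, hua, hve⟩
        · exact Or.inr ⟨_, Finset.mem_insert_self _ _, u, hua, hwg⟩
      · exact Or.inr ⟨b, Finset.mem_insert_of_mem (Finset.mem_erase.2 ⟨hbf, hb⟩), u, hua, hub⟩
    · have hlt : unsaturatedVertices (insert s(w, x) (D.erase s(v, w))) ⊂
          unsaturatedVertices D := by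
        refine (Finset.ssubset_iff_of_subset fun u hu => ?_).2 ⟨x, ?_, ?_⟩
        · simp only [unsaturatedVertices, Finset.mem_filter, Finset.mem_univ, true_and] at hu ⊢
          intro b hb hub
          by_cases hbf : b = s(v, w)
          · subst hbf
            rcases Sym2.mem_iff.1 hub with rfl | rfl
            · exact hu e (Finset.mem_insert_of_mem heE) hve
            · exact hu _ (Finset.mem_insert_self _ _) hwg
          · exact hu b (Finset.mem_insert_of_mem (Finset.mem_erase.2 ⟨hbf, hb⟩)) hub
        · simp only [unsaturatedVertices, Finset.mem_filter, Finset.mem_univ, true_and]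
          intro b hb hxb
          by_cases hbf : b = s(v, w)
          · subst hbf
            rcases Sym2.mem_iff.1 hxb with h | h
            · exact hxv h
            · exact hxw h
          · exact hgc' b (Finset.mem_erase.2 ⟨hbf, hb⟩) x (Sym2.mem_mk_right w x) hxb
        · simp [unsaturatedVertices]
      have := Finset.card_lt_card hlt
      omega

/-- Every edge dominating set is at least as large as some maximal matching. -/
theorem IsEdgeDominatingSet.exists_isMaximalMatching_card_le {D : Finset (Sym2 V)}
    (hD : IsEdgeDominatingSet G D) :
    ∃ M : Finset (Sym2 V), IsMaximalMatching G M ∧ M.card ≤ D.card := by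
  induction hn : 2 * D.card + (unsaturatedVertices D).card using Nat.strong_induction_on
    generalizing D with
  | _ n ih =>
    by_cases hmatch : IsMatchingSet D
    · exact ⟨D, hD.isMaximalMatching hmatch, le_rfl⟩
    · obtain ⟨D', hD', hle, hlt⟩ := hD.exists_improvement hmatch
      obtain ⟨M, hM, hMle⟩ := ih _ (hn ▸ hlt) hD' rfl
      exact ⟨M, hM, hMle.trans hle⟩

theorem IsEdgeDominatingSet.edgeProfit_eq {D : Finset (Sym2 V)}
    (hD : IsEdgeDominatingSet G D) :
    edgeProfit G D = (G.edgeFinset.card : ℤ) - D.card := by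
  classical
  rw [edgeProfit, Finset.filter_true_of_mem hD.2]

/-- Adding all uncovered edges to `F` yields an edge dominating set, and hence a maximal matching
whose size bounds the profit of `F`. -/
theorem exists_isMaximalMatching_edgeProfit_le {F : Finset (Sym2 V)}
    (hF : F ⊆ G.edgeFinset) :
    ∃ M : Finset (Sym2 V), IsMaximalMatching G M ∧
      edgeProfit G F ≤ (G.edgeFinset.card : ℤ) - M.card := by
  classical
  have hD : IsEdgeDominatingSet G (F ∪ G.edgeFinset.filter fun e => ¬ EdgeCovered F e) := by
    refine ⟨Finset.union_subset hF (Finset.filter_subset _ _), fun e he => ?_⟩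
    by_cases hc : EdgeCovered F e
    · obtain ⟨f, hf, h⟩ := edgeCovered_iff.1 hc
      exact Or.inr ⟨f, Finset.mem_union_left _ hf, h⟩
    · exact Or.inl (Finset.mem_union_right _ (Finset.mem_filter.2 ⟨he, hc⟩))
  obtain ⟨M, hM, hle⟩ := hD.exists_isMaximalMatching_card_le
  refine ⟨M, hM, ?_⟩
  have h1 := hle.trans (Finset.card_union_le _ _)
  have h2 := Finset.card_filter_add_card_filter_not (s := G.edgeFinset) (EdgeCovered F)
  have h3 : edgeProfit G F = ((G.edgeFinset.filter (EdgeCovered F)).card : ℤ) - F.card := by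
    unfold edgeProfit
    congr!
  omega

end

theorem max_edgeProfit_eq_card_sub_min_maximal_matching {V : Type*} [Fintype V]
    [DecidableEq V] (G : SimpleGraph V) [DecidableRel G.Adj]
    (hE : G.edgeFinset.Nonempty) :
    (G.edgeFinset.powerset.sup' (Finset.powerset_nonempty _) (edgeProfit G)) =
      (G.edgeFinset.card : ℤ) -
        ((sInf {k : ℕ | ∃ M : Finset (Sym2 V), IsMaximalMatching G M ∧ M.card = k} : ℕ) : ℤ) := by
  have hne : {k : ℕ | ∃ M : Finset (Sym2 V), IsMaximalMatching G M ∧ M.card = k}.Nonempty := by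
    obtain ⟨M, hM, -⟩ :=
      (isEdgeDominatingSet_edgeFinset (G := G)).exists_isMaximalMatching_card_le
    exact ⟨_, M, hM, rfl⟩
  apply le_antisymm
  · refine Finset.sup'_le _ _ fun F hF => ?_
    obtain ⟨M, hM, hle⟩ := exists_isMaximalMatching_edgeProfit_le (Finset.mem_powerset.1 hF)
    have hinf : sInf {k : ℕ | ∃ M : Finset (Sym2 V), IsMaximalMatching G M ∧ M.card = k}
        ≤ M.card := Nat.sInf_le ⟨M, hM, rfl⟩
    omega
  · obtain ⟨M, hM, hcard⟩ := Nat.sInf_mem hne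
    rw [← hcard, ← hM.isEdgeDominatingSet.edgeProfit_eq]
    exact Finset.le_sup' _ (Finset.mem_powerset.2 hM.1)
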